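/- Let l, r ≥ 0 be integers with r + 1 ≤ l ≤ r + 2, let q ≥ 1 be an integer, and let λ₀, λ_∞ be as in the context. For R > 0 define λ_R(s) = λ₀(s) + R·λ_∞(s), and write x_R(θ) = Re λ_R(e^{iθ}), y_R(θ) = Im λ_R(e^{iθ}). Then there exists a constant L > 0, depending only on l, r, q, such that for every R > 0 and every θ ∈ [-π, π], x_R(θ) ≤ -R·L·(y_R(θ))². -/

import Mathlib

/-- Optimal finite-difference coefficients for the first derivative on the
stencil `{-l, …, r}`. -/
noncomputable def aCoef (l r : ℕ) (k : ℤ) : ℝ :=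
  if k = 0 then
    -∑ ν ∈ (Finset.Icc (-(l : ℤ)) (r : ℤ)).erase 0, (1 : ℝ) / (ν : ℝ)
  else
    -((-1 : ℝ) ^ k / (k : ℝ)) *
      ((Nat.factorial l * Nat.factorial r : ℕ) : ℝ) /
      ((Nat.factorial ((l : ℤ) + k).toNat * Nat.factorial ((r : ℤ) - k).toNat : ℕ) : ℝ)

/-- The symbol `λ₀(s) = -Σ_{k=-l}^{r} a_k s^k` of the advection discretization. -/
noncomputable def lam0 (l r : ℕ) (s : ℂ) : ℂ :=
  -∑ k ∈ Finset.Icc (-(l : ℤ)) (r : ℤ), (aCoef l r k : ℂ) * s ^ k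

/-- Optimal centered finite-difference coefficients for the second derivative on
the stencil `{-q, …, q}`. -/
noncomputable def bCoef (q : ℕ) (k : ℤ) : ℝ :=
  if k = 0 then
    -∑ j ∈ Finset.Icc 1 q, 2 / (j : ℝ) ^ 2
  else
    -(2 * (-1 : ℝ) ^ k / (k : ℝ) ^ 2) *
      ((Nat.factorial q * Nat.factorial q : ℕ) : ℝ) /
      ((Nat.factorial ((q : ℤ) + k).toNat * Nat.factorial ((q : ℤ) - k).toNat : ℕ) : ℝ)

/-- The symbol `λ_∞(s) = Σ_{k=-q}^{q} b_k s^k` of the diffusion discretization. -/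
noncomputable def lamInf (q : ℕ) (s : ℂ) : ℂ :=
  ∑ k ∈ Finset.Icc (-(q : ℤ)) (q : ℤ), (bCoef q k : ℂ) * s ^ k

/-- signed binomial sum -/
noncomputable def binSum (l r : ℕ) (s : ℂ) : ℂ :=
  ∑ k ∈ Finset.Icc (-(l : ℤ)) (r : ℤ),
    (((-1 : ℝ) ^ k / ((Nat.factorial ((l : ℤ) + k).toNat * Nat.factorial ((r : ℤ) - k).toNat : ℕ) : ℝ) : ℝ) : ℂ) * s ^ k

theorem binSum_eq (l r : ℕ) (s : ℂ) (hs : s ≠ 0) :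
    binSum l r s = (-1) ^ l * (s⁻¹) ^ l * (1 - s) ^ (l + r) / ((l + r).factorial : ℂ) := by
  unfold binSum
  have e : (1 - s) ^ (l + r) = (-s + 1) ^ (l + r) := by ring
  rw [e, add_pow, Finset.mul_sum, Finset.sum_div]
  symm
  refine Finset.sum_bij (fun (j : ℕ) _ => (j : ℤ) - l) ?_ ?_ ?_ ?_
  · intro j hj
    simp only [Finset.mem_range] at hj
    simp only [Finset.mem_Icc]; omega
  · intro a _ b _ h
    omega
  · intro k hk
    simp only [Finset.mem_Icc] at hk
    refine ⟨(k + l).toNat, ?_, ?_⟩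
    · simp only [Finset.mem_range]; omega
    · omega
  · intro j hj
    simp only [Finset.mem_range] at hj
    have h1 : ((l : ℤ) + ((j : ℤ) - l)).toNat = j := by omega
    have h2 : ((r : ℤ) - ((j : ℤ) - l)).toNat = l + r - j := by omega
    rw [h1, h2, Nat.cast_choose ℂ (by omega : j ≤ l + r), zpow_sub₀ hs,
      zpow_sub₀ (by norm_num : (-1 : ℝ) ≠ 0)]
    have f1 : ((l + r).factorial : ℂ) ≠ 0 := by exact_mod_cast Nat.factorial_ne_zero _
    have f2 : ((l + r - j).factorial : ℂ) ≠ 0 := by exact_mod_cast Nat.factorial_ne_zero _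
    have f3 : (j.factorial : ℂ) ≠ 0 := by exact_mod_cast Nat.factorial_ne_zero _
    have hm : ((-1 : ℂ) ^ l)⁻¹ = (-1) ^ l := by
      rw [← inv_pow]; norm_num
    push_cast
    simp only [zpow_natCast, one_pow, mul_one, neg_pow s j, div_eq_mul_inv, hm]
    have hss : (s⁻¹) ^ l * s ^ l = 1 := by rw [← mul_pow, inv_mul_cancel₀ hs, one_pow]
    rw [inv_pow]
    field_simp

theorem icc_succ_left (l : ℕ) (r : ℤ) (hr : 0 ≤ r) :
    Finset.Icc (-((l + 1 : ℕ) : ℤ)) r = insert (-((l + 1 : ℕ) : ℤ)) (Finset.Icc (-(l : ℤ)) r) := by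
  ext k; simp only [Finset.mem_Icc, Finset.mem_insert]; omega

theorem icc_succ_right (l : ℤ) (r : ℕ) (hl : l ≤ 0) :
    Finset.Icc l ((r + 1 : ℕ) : ℤ) = insert ((r + 1 : ℕ) : ℤ) (Finset.Icc l (r : ℤ)) := by
  ext k; simp only [Finset.mem_Icc, Finset.mem_insert]; omega

theorem aCoef_succ_left (l r : ℕ) (k : ℤ) (hk : -(l : ℤ) ≤ k) (hk' : k ≤ r) :
    aCoef (l + 1) r k = aCoef l r k + (l.factorial * r.factorial : ℝ) *
      ((-1 : ℝ) ^ k / ((Nat.factorial (((l + 1 : ℕ) : ℤ) + k).toNat * Nat.factorial ((r : ℤ) - k).toNat : ℕ) : ℝ)) := by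
  unfold aCoef
  have f1 : (l.factorial : ℝ) ≠ 0 := by exact_mod_cast Nat.factorial_ne_zero _
  have f2 : (r.factorial : ℝ) ≠ 0 := by exact_mod_cast Nat.factorial_ne_zero _
  by_cases h0 : k = 0
  · subst h0
    rw [if_pos rfl, if_pos rfl, icc_succ_left _ _ (by positivity),
      Finset.erase_insert_of_ne (by omega), Finset.sum_insert (by simp)]
    have h1 : (((l + 1 : ℕ) : ℤ) + 0).toNat = l + 1 := by omega
    have h2 : ((r : ℤ) - 0).toNat = r := by omega
    rw [h1, h2, Nat.factorial_succ]
    have : (l : ℝ) + 1 ≠ 0 := by positivity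
    push_cast
    field_simp
    ring
  · rw [if_neg h0, if_neg h0]
    obtain ⟨n, hn⟩ : ∃ n : ℕ, (n : ℤ) = l + k := ⟨(l + k).toNat, by omega⟩
    have h1 : (((l + 1 : ℕ) : ℤ) + k).toNat = n + 1 := by omega
    have h2 : ((l : ℤ) + k).toNat = n := by omega
    have hkr : (k : ℝ) = n - l := by
      have : k = n - l := by omega
      rw [this]; push_cast; ring
    have hk0 : (k : ℝ) ≠ 0 := by exact_mod_cast h0
    rw [h1, h2, Nat.factorial_succ, Nat.factorial_succ]
    have f3 : (n.factorial : ℝ) ≠ 0 := by exact_mod_cast Nat.factorial_ne_zero _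
    have f4 : ((((r : ℤ) - k).toNat).factorial : ℝ) ≠ 0 := by exact_mod_cast Nat.factorial_ne_zero _
    have : (n : ℝ) + 1 ≠ 0 := by positivity
    push_cast
    field_simp
    rw [hkr]; ring

theorem aCoef_succ_right (l r : ℕ) (k : ℤ) (hk : -(l : ℤ) ≤ k) (hk' : k ≤ r) :
    aCoef l (r + 1) k = aCoef l r k - (l.factorial * r.factorial : ℝ) *
      ((-1 : ℝ) ^ k / ((Nat.factorial ((l : ℤ) + k).toNat * Nat.factorial (((r + 1 : ℕ) : ℤ) - k).toNat : ℕ) : ℝ)) := by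
  unfold aCoef
  have f1 : (l.factorial : ℝ) ≠ 0 := by exact_mod_cast Nat.factorial_ne_zero _
  have f2 : (r.factorial : ℝ) ≠ 0 := by exact_mod_cast Nat.factorial_ne_zero _
  by_cases h0 : k = 0
  · subst h0
    rw [if_pos rfl, if_pos rfl, icc_succ_right _ _ (by omega),
      Finset.erase_insert_of_ne (by omega), Finset.sum_insert (by simp)]
    have h1 : (((r + 1 : ℕ) : ℤ) - 0).toNat = r + 1 := by omega
    have h2 : ((l : ℤ) + 0).toNat = l := by omega
    rw [h1, h2, Nat.factorial_succ]
    have : (r : ℝ) + 1 ≠ 0 := by positivity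
    push_cast
    field_simp
    ring
  · rw [if_neg h0, if_neg h0]
    obtain ⟨n, hn⟩ : ∃ n : ℕ, (n : ℤ) = r - k := ⟨(r - k).toNat, by omega⟩
    have h1 : (((r + 1 : ℕ) : ℤ) - k).toNat = n + 1 := by omega
    have h2 : ((r : ℤ) - k).toNat = n := by omega
    have hkr : (k : ℝ) = r - n := by
      have : k = r - n := by omega
      rw [this]; push_cast; ring
    have hk0 : (k : ℝ) ≠ 0 := by exact_mod_cast h0
    rw [h1, h2, Nat.factorial_succ, Nat.factorial_succ]
    have f3 : (n.factorial : ℝ) ≠ 0 := by exact_mod_cast Nat.factorial_ne_zero _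
    have f4 : ((((l : ℤ) + k).toNat).factorial : ℝ) ≠ 0 := by exact_mod_cast Nat.factorial_ne_zero _
    have : (n : ℝ) + 1 ≠ 0 := by positivity
    push_cast
    field_simp
    rw [hkr]; ring

theorem bCoef_succ (q : ℕ) (k : ℤ) (hk : -(q : ℤ) ≤ k) (hk' : k ≤ q) :
    bCoef (q + 1) k = bCoef q k - (2 * (q.factorial * q.factorial) : ℝ) *
      ((-1 : ℝ) ^ k / ((Nat.factorial (((q + 1 : ℕ) : ℤ) + k).toNat * Nat.factorial (((q + 1 : ℕ) : ℤ) - k).toNat : ℕ) : ℝ)) := by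
  unfold bCoef
  have f1 : (q.factorial : ℝ) ≠ 0 := by exact_mod_cast Nat.factorial_ne_zero _
  by_cases h0 : k = 0
  · subst h0
    rw [if_pos rfl, if_pos rfl, Finset.sum_Icc_succ_top (by omega)]
    have h1 : (((q + 1 : ℕ) : ℤ) - 0).toNat = q + 1 := by omega
    have h2 : (((q + 1 : ℕ) : ℤ) + 0).toNat = q + 1 := by omega
    rw [h1, h2, Nat.factorial_succ]
    have : (q : ℝ) + 1 ≠ 0 := by positivity
    push_cast
    field_simp
    ring
  · rw [if_neg h0, if_neg h0]
    obtain ⟨n, hn⟩ : ∃ n : ℕ, (n : ℤ) = q - k := ⟨(q - k).toNat, by omega⟩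
    obtain ⟨m, hm⟩ : ∃ m : ℕ, (m : ℤ) = q + k := ⟨(q + k).toNat, by omega⟩
    have h1 : (((q + 1 : ℕ) : ℤ) - k).toNat = n + 1 := by omega
    have h2 : ((q : ℤ) - k).toNat = n := by omega
    have h3 : (((q + 1 : ℕ) : ℤ) + k).toNat = m + 1 := by omega
    have h4 : ((q : ℤ) + k).toNat = m := by omega
    have hnr : (n : ℝ) = q - k := by exact_mod_cast hn
    have hmr : (m : ℝ) = q + k := by exact_mod_cast hm
    have hk0 : (k : ℝ) ≠ 0 := by exact_mod_cast h0
    rw [h1, h2, h3, h4, Nat.factorial_succ, Nat.factorial_succ, Nat.factorial_succ]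
    have f3 : (n.factorial : ℝ) ≠ 0 := by exact_mod_cast Nat.factorial_ne_zero _
    have f4 : (m.factorial : ℝ) ≠ 0 := by exact_mod_cast Nat.factorial_ne_zero _
    have : (n : ℝ) + 1 ≠ 0 := by positivity
    have : (m : ℝ) + 1 ≠ 0 := by positivity
    push_cast
    field_simp
    rw [hnr, hmr]; ring

theorem sum_lin (S : Finset ℤ) (f g h : ℤ → ℝ) (c : ℝ) (s : ℂ)
    (H : ∀ k ∈ S, f k = g k + c * h k) :
    ∑ k ∈ S, (f k : ℂ) * s ^ k = ∑ k ∈ S, (g k : ℂ) * s ^ k + (c : ℂ) * ∑ k ∈ S, (h k : ℂ) * s ^ k := by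
  rw [Finset.mul_sum, ← Finset.sum_add_distrib]
  refine Finset.sum_congr rfl fun k hk => ?_
  rw [H k hk]; push_cast; ring

theorem lam0_succ_left (l r : ℕ) (s : ℂ) :
    lam0 (l + 1) r s = lam0 l r s - (l.factorial * r.factorial : ℝ) * binSum (l + 1) r s := by
  unfold lam0 binSum
  rw [icc_succ_left _ _ (by positivity), Finset.sum_insert (by simp), Finset.sum_insert (by simp),
    sum_lin _ _ _ _ (l.factorial * r.factorial : ℝ) s (fun k hk => by
      rw [Finset.mem_Icc] at hk
      rw [aCoef_succ_left l r k hk.1 hk.2])]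
  have : aCoef (l + 1) r (-((l + 1 : ℕ) : ℤ)) = (l.factorial * r.factorial : ℝ) *
      ((-1 : ℝ) ^ (-((l + 1 : ℕ) : ℤ)) / ((Nat.factorial (((l + 1 : ℕ) : ℤ) + (-((l + 1 : ℕ) : ℤ))).toNat *
        Nat.factorial ((r : ℤ) - (-((l + 1 : ℕ) : ℤ))).toNat : ℕ) : ℝ)) := by
    unfold aCoef
    rw [if_neg (by omega), Nat.factorial_succ]
    push_cast
    have : (l : ℝ) + 1 ≠ 0 := by positivity
    field_simp
    try ring
  rw [this, Complex.ofReal_mul _ (_ / _)]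
  ring

theorem lam0_succ_right (l r : ℕ) (s : ℂ) :
    lam0 l (r + 1) s = lam0 l r s + (l.factorial * r.factorial : ℝ) * binSum l (r + 1) s := by
  unfold lam0 binSum
  rw [icc_succ_right _ _ (by omega), Finset.sum_insert (by simp), Finset.sum_insert (by simp),
    sum_lin _ _ _ _ (-(l.factorial * r.factorial : ℝ)) s (fun k hk => by
      rw [Finset.mem_Icc] at hk
      rw [aCoef_succ_right l r k hk.1 hk.2, sub_eq_add_neg, ← neg_mul])]
  have : aCoef l (r + 1) ((r + 1 : ℕ) : ℤ) = -((l.factorial * r.factorial : ℝ) *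
      ((-1 : ℝ) ^ ((r + 1 : ℕ) : ℤ) / ((Nat.factorial ((l : ℤ) + ((r + 1 : ℕ) : ℤ)).toNat *
        Nat.factorial (((r + 1 : ℕ) : ℤ) - ((r + 1 : ℕ) : ℤ)).toNat : ℕ) : ℝ))) := by
    unfold aCoef
    rw [if_neg (by omega), Nat.factorial_succ]
    push_cast
    have : (r : ℝ) + 1 ≠ 0 := by positivity
    field_simp
    try ring
  rw [this, Complex.ofReal_neg, Complex.ofReal_neg, Complex.ofReal_mul _ (_ / _)]
  ring

theorem lamInf_succ (q : ℕ) (s : ℂ) :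
    lamInf (q + 1) s = lamInf q s - (2 * (q.factorial * q.factorial) : ℝ) * binSum (q + 1) (q + 1) s := by
  unfold lamInf binSum
  have hI : Finset.Icc (-((q + 1 : ℕ) : ℤ)) ((q + 1 : ℕ) : ℤ) =
      insert (-((q + 1 : ℕ) : ℤ)) (insert ((q + 1 : ℕ) : ℤ) (Finset.Icc (-(q : ℤ)) (q : ℤ))) := by
    rw [icc_succ_left _ _ (by positivity), icc_succ_right _ _ (by omega)]
  have n1 : -((q + 1 : ℕ) : ℤ) ∉ (insert ((q + 1 : ℕ) : ℤ) (Finset.Icc (-(q : ℤ)) (q : ℤ))) := by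
    simp only [Finset.mem_insert, Finset.mem_Icc]; omega
  have n2 : ((q + 1 : ℕ) : ℤ) ∉ (Finset.Icc (-(q : ℤ)) (q : ℤ)) := by
    simp only [Finset.mem_Icc]; omega
  rw [hI, Finset.sum_insert n1, Finset.sum_insert n1, Finset.sum_insert n2, Finset.sum_insert n2,
    sum_lin _ _ _ _ (-(2 * (q.factorial * q.factorial) : ℝ)) s (fun k hk => by
      rw [Finset.mem_Icc] at hk
      rw [bCoef_succ q k hk.1 hk.2, sub_eq_add_neg, ← neg_mul])]
  have key : ∀ k : ℤ, k ≠ 0 → k ^ 2 = (q + 1) ^ 2 → bCoef (q + 1) k = -((2 * (q.factorial * q.factorial) : ℝ) *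
      ((-1 : ℝ) ^ k / ((Nat.factorial (((q + 1 : ℕ) : ℤ) + k).toNat *
        Nat.factorial (((q + 1 : ℕ) : ℤ) - k).toNat : ℕ) : ℝ))) := by
    intro k hk hk2
    have hk3 : (k : ℝ) ^ 2 = (q + 1) ^ 2 := by exact_mod_cast hk2
    unfold bCoef
    rw [if_neg hk, Nat.factorial_succ, hk3]
    push_cast
    have : (q : ℝ) + 1 ≠ 0 := by positivity
    field_simp
    try ring
  rw [key (-((q + 1 : ℕ) : ℤ)) (by omega) (by push_cast; ring),
    key (((q + 1 : ℕ) : ℤ)) (by omega) (by push_cast; ring),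
    Complex.ofReal_neg, Complex.ofReal_neg, Complex.ofReal_neg, Complex.ofReal_mul _ (_ / _),
    Complex.ofReal_mul _ (_ / _)]
  ring

theorem binSum_sym (r : ℕ) (s : ℂ) (hs : s ≠ 0) :
    binSum r r s = ((1 - s) * (1 - s⁻¹)) ^ r / ((2 * r).factorial : ℂ) := by
  rw [binSum_eq _ _ _ hs, ← two_mul, pow_mul, ← mul_pow, ← mul_pow]
  congr 2
  field_simp
  ring

theorem binSum_one (r : ℕ) (s : ℂ) (hs : s ≠ 0) :
    binSum (r + 1) r s = ((1 - s) * (1 - s⁻¹)) ^ r * (1 - s⁻¹) / ((2 * r + 1).factorial : ℂ) := by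
  have e : (1 - s) * (1 - s⁻¹) = -1 * s⁻¹ * (1 - s) ^ 2 := by field_simp; ring
  have e2 : (1 - s⁻¹) = -1 * s⁻¹ * (1 - s) := by field_simp; ring
  rw [binSum_eq _ _ _ hs, show r + 1 + r = 2 * r + 1 by ring, e, e2, mul_pow _ _ r, ← pow_mul]
  ring

theorem binSum_two (r : ℕ) (s : ℂ) (hs : s ≠ 0) :
    binSum (r + 2) r s = ((1 - s) * (1 - s⁻¹)) ^ r * (1 - s⁻¹) ^ 2 / ((2 * r + 2).factorial : ℂ) := by
  have e : (1 - s) * (1 - s⁻¹) = -1 * s⁻¹ * (1 - s) ^ 2 := by field_simp; ring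
  have e2 : (1 - s⁻¹) = -1 * s⁻¹ * (1 - s) := by field_simp; ring
  rw [binSum_eq _ _ _ hs, show r + 2 + r = 2 * r + 2 by ring, e, e2, mul_pow _ _ r, ← pow_mul]
  ring

theorem exp_facts (θ : ℝ) : (1 - Complex.exp (θ * Complex.I)) * (1 - (Complex.exp (θ * Complex.I))⁻¹) =
      ((2 - 2 * Real.cos θ : ℝ) : ℂ) ∧
    (1 - (Complex.exp (θ * Complex.I))⁻¹) = ((1 - Real.cos θ : ℝ) : ℂ) + (Real.sin θ : ℝ) * Complex.I := by
  have h2 : (1 - (Complex.exp (θ * Complex.I))⁻¹) =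
      ((1 - Real.cos θ : ℝ) : ℂ) + (Real.sin θ : ℝ) * Complex.I := by
    rw [← Complex.exp_neg, ← neg_mul, Complex.exp_mul_I]
    simp only [Complex.cos_neg, Complex.sin_neg]
    push_cast; ring
  refine ⟨?_, h2⟩
  rw [h2, Complex.exp_mul_I]
  push_cast
  have := Complex.sin_sq_add_cos_sq (θ : ℂ)
  have hI := Complex.I_sq
  linear_combination this - (Complex.sin θ)^2 * hI

theorem re_binSum_sym (r : ℕ) (θ : ℝ) :
    binSum r r (Complex.exp (θ * Complex.I)) =
      (((2 - 2 * Real.cos θ) ^ r / ((2 * r).factorial : ℝ) : ℝ) : ℂ) := by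
  rw [binSum_sym _ _ (Complex.exp_ne_zero _), (exp_facts θ).1]
  push_cast; rfl

theorem re_binSum_one (r : ℕ) (θ : ℝ) :
    (binSum (r + 1) r (Complex.exp (θ * Complex.I))).re =
      (2 - 2 * Real.cos θ) ^ r * (1 - Real.cos θ) / ((2 * r + 1).factorial : ℝ) := by
  rw [binSum_one _ _ (Complex.exp_ne_zero _), (exp_facts θ).1, (exp_facts θ).2,
    ← Complex.ofReal_pow, ← Complex.ofReal_natCast, Complex.div_ofReal_re, Complex.re_ofReal_mul]
  simp only [Complex.add_re, Complex.ofReal_re, Complex.re_ofReal_mul, Complex.I_re, mul_zero, add_zero]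

theorem re_binSum_two (r : ℕ) (θ : ℝ) :
    (binSum (r + 2) r (Complex.exp (θ * Complex.I))).re =
      (2 - 2 * Real.cos θ) ^ r * (-2 * Real.cos θ * (1 - Real.cos θ)) / ((2 * r + 2).factorial : ℝ) := by
  rw [binSum_two _ _ (Complex.exp_ne_zero _), (exp_facts θ).1, (exp_facts θ).2,
    ← Complex.ofReal_pow, ← Complex.ofReal_natCast, Complex.div_ofReal_re, Complex.re_ofReal_mul]
  congr 2
  have : (((1 - Real.cos θ : ℝ) : ℂ) + (Real.sin θ : ℝ) * Complex.I) ^ 2 =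
    (((1 - Real.cos θ) ^ 2 - Real.sin θ ^ 2 : ℝ) : ℂ) + ((2 * (1 - Real.cos θ) * Real.sin θ : ℝ) : ℂ) * Complex.I := by
    push_cast
    linear_combination (Complex.sin θ)^2 * Complex.I_sq
  rw [this]
  simp only [Complex.add_re, Complex.ofReal_re, Complex.re_ofReal_mul, Complex.I_re]
  have := Real.sin_sq_add_cos_sq θ
  linear_combination -this

theorem re_lam0_one (r : ℕ) (θ : ℝ) :
    (lam0 (r + 1) r (Complex.exp (θ * Complex.I))).re =
      (lam0 r r (Complex.exp (θ * Complex.I))).re - (r.factorial * r.factorial : ℝ) *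
      ((2 - 2 * Real.cos θ) ^ r * (1 - Real.cos θ) / ((2 * r + 1).factorial : ℝ)) := by
  rw [lam0_succ_left, Complex.sub_re, Complex.re_ofReal_mul, re_binSum_one]

theorem re_lam0_sym (r : ℕ) (θ : ℝ) :
    (lam0 r r (Complex.exp (θ * Complex.I))).re = 0 := by
  induction r with
  | zero => simp [lam0, aCoef]
  | succ r ih =>
    rw [lam0_succ_right, Complex.add_re, Complex.re_ofReal_mul, re_lam0_one, ih, re_binSum_sym,
      Complex.ofReal_re, show 2 * (r + 1) = (2 * r + 1) + 1 by ring, Nat.factorial_succ (2 * r + 1),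
      Nat.factorial_succ r]
    have f3 : ((2 * r + 1).factorial : ℝ) ≠ 0 := by exact_mod_cast Nat.factorial_ne_zero _
    have : (r : ℝ) + 1 ≠ 0 := by positivity
    have : (2 * r + 1 + 1 : ℝ) ≠ 0 := by positivity
    push_cast
    field_simp
    ring

theorem re_lam0_nonpos (l r : ℕ) (h1 : r + 1 ≤ l) (h2 : l ≤ r + 2) (θ : ℝ) :
    (lam0 l r (Complex.exp (θ * Complex.I))).re ≤ 0 := by
  have hc : 0 ≤ 1 - Real.cos θ := by linarith [Real.cos_le_one θ]
  have hw : 0 ≤ 2 - 2 * Real.cos θ := by linarith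
  obtain rfl | rfl : l = r + 1 ∨ l = r + 2 := by omega
  · rw [re_lam0_one, re_lam0_sym]
    have : 0 ≤ (r.factorial * r.factorial : ℝ) *
      ((2 - 2 * Real.cos θ) ^ r * (1 - Real.cos θ) / ((2 * r + 1).factorial : ℝ)) := by positivity
    linarith
  · rw [show r + 2 = (r + 1) + 1 by ring, lam0_succ_left, Complex.sub_re, Complex.re_ofReal_mul,
      re_lam0_one, re_lam0_sym, show r + 1 + 1 = r + 2 by ring, re_binSum_two,
      show 2 * r + 2 = (2 * r + 1) + 1 by ring, Nat.factorial_succ (2 * r + 1), Nat.factorial_succ r]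
    have f3 : ((2 * r + 1).factorial : ℝ) ≠ 0 := by exact_mod_cast Nat.factorial_ne_zero _
    have h : 0 ≤ (r.factorial * r.factorial : ℝ) *
      ((2 - 2 * Real.cos θ) ^ r * (1 - Real.cos θ) ^ 2 / ((2 * r + 1).factorial : ℝ)) := by positivity
    have : (r : ℝ) + 1 ≠ 0 := by positivity
    have : (2 * r + 1 + 1 : ℝ) ≠ 0 := by positivity
    refine le_of_eq_of_le ?_ (neg_nonpos.mpr h)
    push_cast
    field_simp
    ring

theorem lamInf_real (q : ℕ) (θ : ℝ) :
    ∃ x : ℝ, lamInf (q + 1) (Complex.exp (θ * Complex.I)) = (x : ℂ) ∧ x ≤ -(2 - 2 * Real.cos θ) := by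
  have hw : 0 ≤ 2 - 2 * Real.cos θ := by linarith [Real.cos_le_one θ]
  induction q with
  | zero =>
    refine ⟨-(2 - 2 * Real.cos θ), ?_, le_rfl⟩
    rw [lamInf_succ, re_binSum_sym]
    simp [lamInf, bCoef]
    ring
  | succ q ih =>
    obtain ⟨x, hx, hx'⟩ := ih
    rw [lamInf_succ, re_binSum_sym, hx, ← Complex.ofReal_mul, ← Complex.ofReal_sub]
    refine ⟨_, rfl, ?_⟩
    have : 0 ≤ (2 * ((q + 1).factorial * (q + 1).factorial) : ℝ) *
      ((2 - 2 * Real.cos θ) ^ (q + 1 + 1) / ((2 * (q + 1 + 1)).factorial : ℝ)) := by positivity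
    linarith

theorem im_lam0_bound (l r : ℕ) : ∃ C : ℝ, 0 < C ∧ ∀ θ : ℝ,
    (lam0 l r (Complex.exp (θ * Complex.I))).im ^ 2 ≤ C * (2 - 2 * Real.cos θ) := by
  set A : ℝ := ∑ k ∈ Finset.Icc (-(l : ℤ)) (r : ℤ), |aCoef l r k| * (k.natAbs : ℝ) with hA
  refine ⟨A ^ 2 + 1, by positivity, fun θ => ?_⟩
  have key : |(lam0 l r (Complex.exp (θ * Complex.I))).im| ≤ A * |Real.sin θ| := by
    unfold lam0
    rw [Complex.neg_im, abs_neg, Complex.im_sum, hA, Finset.sum_mul]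
    refine (Finset.abs_sum_le_sum_abs _ _).trans (Finset.sum_le_sum fun k _ => ?_)
    rw [Complex.im_ofReal_mul, abs_mul, mul_assoc]
    refine mul_le_mul_of_nonneg_left ?_ (abs_nonneg _)
    have e : (Complex.exp (θ * Complex.I) ^ k).im = Real.sin (k * θ) := by
      rw [← Complex.exp_int_mul, show (k : ℂ) * (θ * Complex.I) = ((k * θ : ℝ) : ℂ) * Complex.I by
        push_cast; ring, Complex.exp_ofReal_mul_I_im]
    rw [e]
    have hn : ∀ n : ℕ, |Real.sin (n * θ)| ≤ n * |Real.sin θ| := by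
      intro n
      induction n with
      | zero => simp
      | succ n ih =>
        rw [show ((n + 1 : ℕ) : ℝ) * θ = n * θ + θ by push_cast; ring, Real.sin_add]
        refine (abs_add_le _ _).trans ?_
        rw [abs_mul, abs_mul]
        have c1 := Real.abs_cos_le_one θ
        have c2 := Real.abs_cos_le_one (n * θ)
        have := mul_le_mul_of_nonneg_left c1 (abs_nonneg (Real.sin (n * θ)))
        have := mul_le_mul_of_nonneg_right c2 (abs_nonneg (Real.sin θ))
        push_cast
        linarith
    rcases Int.natAbs_eq k with h | h
    · have : (k : ℝ) = (k.natAbs : ℝ) := by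
        conv_lhs => rw [h]
        exact Int.cast_natCast _
      rw [this]; exact hn _
    · have : (k : ℝ) = -(k.natAbs : ℝ) := by
        conv_lhs => rw [h]
        rw [Int.cast_neg, Int.cast_natCast]
      rw [this, neg_mul, Real.sin_neg, abs_neg]; exact hn _
  have h2 := pow_le_pow_left₀ (abs_nonneg _) key 2
  rw [sq_abs, mul_pow, sq_abs] at h2
  have hs : Real.sin θ ^ 2 ≤ 2 - 2 * Real.cos θ := by
    nlinarith [Real.sin_sq_add_cos_sq θ, sq_nonneg (1 - Real.cos θ)]
  have h3 := mul_le_mul_of_nonneg_left hs (sq_nonneg A)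
  nlinarith [sq_nonneg (Real.sin θ)]

/-- Global bound on the advection-diffusion eigenvalue trajectory:
there is `L > 0` (depending only on the discretizations) with
`x_R(θ) ≤ -R·L·y_R(θ)²` for all `R > 0` and `θ ∈ [-π, π]`. -/
theorem lamR_global_bound (l r : ℕ) (h1 : r + 1 ≤ l) (h2 : l ≤ r + 2)
    (q : ℕ) (hq : 1 ≤ q) :
    ∃ L > (0 : ℝ), ∀ R : ℝ, 0 < R → ∀ θ ∈ Set.Icc (-Real.pi) Real.pi,
      (lam0 l r (Complex.exp (θ * Complex.I)) +
          (R : ℂ) * lamInf q (Complex.exp (θ * Complex.I))).re ≤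
        -(R * L * (lam0 l r (Complex.exp (θ * Complex.I)) +
            (R : ℂ) * lamInf q (Complex.exp (θ * Complex.I))).im ^ 2) := by
  obtain ⟨C, hC, hb⟩ := im_lam0_bound l r
  refine ⟨C⁻¹, by positivity, fun R hR θ _ => ?_⟩
  obtain ⟨q, rfl⟩ : ∃ p, q = p + 1 := ⟨q - 1, by omega⟩
  obtain ⟨x, hx, hx'⟩ := lamInf_real q θ
  rw [hx, ← Complex.ofReal_mul, Complex.add_re, Complex.add_im, Complex.ofReal_re,
    Complex.ofReal_im, add_zero]
  have h0 := re_lam0_nonpos l r h1 h2 θ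
  have h3 : C⁻¹ * (lam0 l r (Complex.exp (θ * Complex.I))).im ^ 2 ≤ 2 - 2 * Real.cos θ := by
    rw [inv_mul_le_iff₀ hC]; exact hb θ
  have h4 : R * (x + C⁻¹ * (lam0 l r (Complex.exp (θ * Complex.I))).im ^ 2) ≤ 0 :=
    mul_nonpos_of_nonneg_of_nonpos hR.le (by linarith)
  linarith
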